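/- Let T be an ℝ-tree with a very small, minimal, isometric action of the free group F_N (N ≥ 2) with dense orbits, let 𝒜 be a basis of F_N, and let K ⊆ T̄ be a compact subtree with K ∩ aK ≠ ∅ for every a ∈ 𝒜. Then the induced system of isometries 𝒦 = (K,𝒜) has independent generators: for every admissible infinite word X ∈ ∂F(𝒜), the non-empty domain dom(X) consists of exactly one point. -/

import Mathlib

/-!
Common formalization framework for "ℝ-trees, dual laminations, and compact systems
of partial isometries" (Coulbois–Hilion–Lustig).
-/

open Set Filter Topology Pointwise

noncomputable section

namespace CHL

/-! ### ℝ-trees -/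

/-- The metric betweenness segment `[x,y]`.  In an ℝ-tree this is exactly the unique
topological arc joining `x` to `y`, which is a geodesic segment. -/
def seg {T : Type*} [MetricSpace T] (x y : T) : Set T :=
  {z | dist x z + dist z y = dist x y}

/-- An ℝ-tree: a geodesic metric space which is `0`-hyperbolic (four point condition).
Equivalently, any two points are joined by a unique topological arc, and this arc is a
geodesic segment. -/
class IsRTree (T : Type*) [MetricSpace T] : Prop where
  geodesic : ∀ x y : T, ∃ f : ℝ → T, f 0 = x ∧ f (dist x y) = y ∧
      ∀ s ∈ Set.Icc (0 : ℝ) (dist x y), ∀ t ∈ Set.Icc (0 : ℝ) (dist x y),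
        dist (f s) (f t) = |s - t|
  four_point : ∀ x y z w : T,
      dist x y + dist z w ≤ max (dist x z + dist y w) (dist x w + dist y z)

/-- A subtree of an ℝ-tree: a convex subset. -/
def IsSubtree {T : Type*} [MetricSpace T] (A : Set T) : Prop :=
  ∀ x ∈ A, ∀ y ∈ A, seg x y ⊆ A

/-- A non-empty closed subtree. -/
def IsClosedSubtree {T : Type*} [MetricSpace T] (A : Set T) : Prop :=
  A.Nonempty ∧ IsClosed A ∧ IsSubtree A

/-- The convex hull of a subset of an ℝ-tree: the smallest subtree containing it. -/
def subtreeHull {T : Type*} [MetricSpace T] (S : Set T) : Set T :=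
  ⋂₀ {A : Set T | S ⊆ A ∧ IsSubtree A}

/-- A finite tree: the convex hull of finitely many points. -/
def IsFiniteSubtree {T : Type*} [MetricSpace T] (A : Set T) : Prop :=
  ∃ F : Finset T, A = subtreeHull (F : Set T)

/-- `[x,x']` is the segment joining `A` to `B`: its endpoints are the only points
in `A` resp. `B` that it meets. -/
def IsBridge {T : Type*} [MetricSpace T] (A B : Set T) (x x' : T) : Prop :=
  x ∈ A ∧ x' ∈ B ∧ seg x x' ∩ A = {x} ∧ seg x x' ∩ B = {x'}

/-- A morphism of ℝ-trees: a continuous map such that every segment is mapped locally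
injectively except at finitely many points. -/
def IsTreeMorphism {T T' : Type*} [MetricSpace T] [MetricSpace T'] (f : T → T') : Prop :=
  Continuous f ∧ ∀ x y : T, ∃ F : Finset T, ∀ p ∈ seg x y, p ∉ (F : Set T) →
    ∃ U ∈ nhdsWithin p (seg x y), Set.InjOn f U

/-- The translation length `‖g‖_T = inf_{x ∈ T} d(x, gx)`. -/
def translationLength (G : Type*) [Group G] (T : Type*) [MetricSpace T] [MulAction G T]
    (g : G) : ℝ :=
  ⨅ x : T, dist x (g • x)

/-- The translation length of `g` on an invariant subtree `A`. -/
def translationLengthOn {G : Type*} [Group G] {T : Type*} [MetricSpace T] [MulAction G T]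
    (A : Set T) (g : G) : ℝ :=
  ⨅ x : A, dist (x : T) (g • (x : T))

/-- The minimal `G`-invariant subtree. -/
def minSubtree (G : Type*) [Group G] (T : Type*) [MetricSpace T] [MulAction G T] : Set T :=
  ⋂₀ {A : Set T | A.Nonempty ∧ IsSubtree A ∧ ∀ g : G, ∀ x ∈ A, g • x ∈ A}

/-! ### Free groups, reduced words and the boundary `∂F(𝒜)` -/

/-- Two letters of `𝒜^{±1}` are inverse to each other. -/
def LettersInv {ι : Type*} (a b : ι × Bool) : Prop := a.1 = b.1 ∧ a.2 = !b.2

/-- The prefix of length `n` of (the reduced word of) `w`. -/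
def gprefix {ι : Type*} [DecidableEq ι] (w : FreeGroup ι) (n : ℕ) : FreeGroup ι :=
  FreeGroup.mk (w.toWord.take n)

/-- An infinite reduced word in the letters `𝒜^{±1}`: a point of the Gromov boundary
`∂F(𝒜)` of the free group `F(𝒜)`. -/
structure InfWord (ι : Type*) where
  letter : ℕ → ι × Bool
  reduced : ∀ n, ¬ LettersInv (letter n) (letter (n + 1))

/-- The prefix `X_n` of length `n` of an infinite reduced word `X`. -/
def InfWord.prefixN {ι : Type*} (X : InfWord ι) (n : ℕ) : FreeGroup ι :=
  FreeGroup.mk (List.ofFn fun i : Fin n => X.letter i)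

/-- The infinite word `X_k⁻¹ X` obtained by deleting the first `k` letters. -/
def InfWord.shift {ι : Type*} (X : InfWord ι) (k : ℕ) : InfWord ι :=
  ⟨fun n => X.letter (k + n), fun n => X.reduced (k + n)⟩

/-- A sequence `wₙ ∈ F(𝒜)` converges in `F(𝒜) ∪ ∂F(𝒜)` to the infinite word `X` iff
the length of the maximal common prefix of `wₙ` and `X` tends to infinity. -/
def TendstoBoundary {ι : Type*} [DecidableEq ι] (w : ℕ → FreeGroup ι) (X : InfWord ι) : Prop :=
  ∀ k : ℕ, ∀ᶠ n in atTop, (w n).toWord.take k = List.ofFn fun i : Fin k => X.letter i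

/-- `Y = w · X` for the left action of `F(𝒜)` on its boundary `∂F(𝒜)`. -/
def SmulBoundary {ι : Type*} [DecidableEq ι] (w : FreeGroup ι) (X Y : InfWord ι) : Prop :=
  TendstoBoundary (fun n => w * X.prefixN n) Y

/-- The (Cantor set) topology on `∂F(𝒜)`, induced by the product topology on sequences
of letters. -/
instance {ι : Type*} : TopologicalSpace (InfWord ι) :=
  TopologicalSpace.induced (fun X => X.letter)
    (@Pi.topologicalSpace ℕ (fun _ => ι × Bool) fun _ => ⊥)

/-- A non-trivial element of `F(𝒜)` is cyclically reduced if the first letter of its reduced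
word is not the inverse of its last letter. -/
def IsCyclicallyReduced {ι : Type*} [DecidableEq ι] (w : FreeGroup ι) : Prop :=
  w ≠ 1 ∧ ∀ a ∈ w.toWord.head?, ∀ b ∈ w.toWord.getLast?, ¬ LettersInv a b

/-- The dual laminary language `ℒ_𝒜(T)` of an isometric action of `F(𝒜)` on `T`. -/
def dualLanguage (ι : Type*) [DecidableEq ι] (T : Type*) [MetricSpace T]
    [MulAction (FreeGroup ι) T] : Set (FreeGroup ι) :=
  {v | ∀ ε > (0 : ℝ), ∃ u w : FreeGroup ι,
      (u * v * w).toWord = u.toWord ++ v.toWord ++ w.toWord ∧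
      IsCyclicallyReduced (u * v * w) ∧
      translationLength (FreeGroup ι) T (u * v * w) < ε}

/-- The dual laminary language `ℒ_𝒜(T)`, for the action restricted to an invariant
subtree `A`. -/
def dualLanguageOn (ι : Type*) [DecidableEq ι] {T : Type*} [MetricSpace T]
    [MulAction (FreeGroup ι) T] (A : Set T) : Set (FreeGroup ι) :=
  {v | ∀ ε > (0 : ℝ), ∃ u w : FreeGroup ι,
      (u * v * w).toWord = u.toWord ++ v.toWord ++ w.toWord ∧
      IsCyclicallyReduced (u * v * w) ∧
      translationLengthOn A (u * v * w) < ε}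

/-! ### Systems of isometries on a compact ℝ-tree -/

/-- A system of isometries `𝒦 = (K, 𝒜)`: a family, indexed by `ι`, of non-empty partial
isometries of the compact ℝ-tree `K`, i.e. isometries between non-empty closed subtrees. -/
structure SystemOfIsometries (K : Type*) [MetricSpace K] (ι : Type*) where
  pe : ι → PartialEquiv K K
  isom : ∀ i, ∀ x ∈ (pe i).source, ∀ y ∈ (pe i).source, dist (pe i x) (pe i y) = dist x y
  source_subtree : ∀ i, IsClosedSubtree (pe i).source
  target_subtree : ∀ i, IsClosedSubtree (pe i).target

namespace SystemOfIsometries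

variable {K : Type*} [MetricSpace K] {ι : Type*} (S : SystemOfIsometries K ι)

/-- The partial isometry associated to a letter in `𝒜^{±1}`. -/
def letterPE : ι × Bool → PartialEquiv K K
  | (i, true) => S.pe i
  | (i, false) => (S.pe i).symm

/-- The partial isometry `z₁ ∘ z₂ ∘ ⋯ ∘ zₙ` (acting on the right: first `z₁`, then `z₂`, …)
associated to the reduced word `w = z₁ ⋯ zₙ ∈ F(𝒜)`. -/
def wordPE [DecidableEq ι] (w : FreeGroup ι) : PartialEquiv K K :=
  (w.toWord.map S.letterPE).foldl PartialEquiv.trans (PartialEquiv.refl K)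

/-- The domain `dom (w)` of the partial isometry associated to `w`. -/
def dom [DecidableEq ι] (w : FreeGroup ι) : Set K := (S.wordPE w).source

/-- A word is admissible if it is non-empty as a partial isometry of `K`. -/
def Admissible [DecidableEq ι] (w : FreeGroup ι) : Prop := (S.dom w).Nonempty

/-- An infinite word is admissible if all its prefixes are admissible. -/
def AdmissibleInf [DecidableEq ι] (X : InfWord ι) : Prop := ∀ n, S.Admissible (X.prefixN n)

/-- The domain of an infinite word: the intersection of the domains of its prefixes. -/
def domInf [DecidableEq ι] (X : InfWord ι) : Set K := ⋂ n, S.dom (X.prefixN n)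

/-- An infinite word `X` is eventually admissible if some suffix `X_k⁻¹ X` is admissible. -/
def EventuallyAdmissible [DecidableEq ι] (X : InfWord ι) : Prop :=
  ∃ k, S.AdmissibleInf (X.shift k)

/-- The system `𝒦` has independent generators if the (non-empty) domain of every
admissible infinite word consists of exactly one point. -/
def IndependentGenerators [DecidableEq ι] : Prop :=
  ∀ X : InfWord ι, S.AdmissibleInf X → ∃ x : K, S.domInf X = {x}

/-- The admissible laminary language `ℒ_adm(𝒦)`: the largest laminary language consisting of
admissible words; `w ∈ ℒ_adm(𝒦)` iff for every `k` the word `w` is obtained from some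
admissible word `v` by deleting its prefix and its suffix of length `k`. -/
def admLanguage [DecidableEq ι] : Set (FreeGroup ι) :=
  {w | ∀ k : ℕ, ∃ v : FreeGroup ι, S.Admissible v ∧
      ∃ p s : List (ι × Bool), p.length = k ∧ s.length = k ∧
        v.toWord = p ++ w.toWord ++ s}

end SystemOfIsometries

/-- The ℝ-tree `T_𝒦` associated to a system of isometries `𝒦 = (K, 𝒜)`, presented through
its characteristic properties (Theorem 3.2 of the paper, by which it is unique):
`T_𝒦` contains `K` as an isometrically embedded subtree (1); the left action of `F(𝒜)`
is compatible with the partial isometries (2); every orbit meets `K`, and indeed every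
segment is covered by finitely many translates of `K` (3); and `T_𝒦` is universal among
trees satisfying (1) and (2), via unique equivariant morphisms (4). -/
structure AssocTree {K : Type} [MetricSpace K] {ι : Type} [DecidableEq ι]
    (S : SystemOfIsometries K ι) where
  carrier : Type
  [ms : MetricSpace carrier]
  tree : IsRTree carrier
  [act : MulAction (FreeGroup ι) carrier]
  act_isom : ∀ g : FreeGroup ι, Isometry fun x : carrier => g • x
  emb : K → carrier
  emb_isom : Isometry emb
  emb_subtree : IsSubtree (Set.range emb)
  compat : ∀ i : ι, ∀ x ∈ (S.pe i).source, (FreeGroup.of i)⁻¹ • emb x = emb (S.pe i x)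
  orbit_meets : ∀ p : carrier, ∃ (w : FreeGroup ι) (x : K), p = w • emb x
  seg_cover : ∀ p q : carrier, ∃ F : Finset (FreeGroup ι),
      seg p q ⊆ ⋃ w ∈ F, w • Set.range emb
  universal : ∀ (T' : Type) [MetricSpace T'] [MulAction (FreeGroup ι) T'],
      (∀ g : FreeGroup ι, Isometry fun x : T' => g • x) →
      ∀ e' : K → T', Isometry e' →
      (∀ i : ι, ∀ x ∈ (S.pe i).source, (FreeGroup.of i)⁻¹ • e' x = e' (S.pe i x)) →
      ∃! f : carrier → T', IsTreeMorphism f ∧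
        (∀ (g : FreeGroup ι) (p : carrier), f (g • p) = g • f p) ∧
        ∀ x : K, f (emb x) = e' x

attribute [instance] AssocTree.ms AssocTree.act

/-! ### Very small minimal actions with dense orbits, and their metric completion -/

/-- An ℝ-tree `T` (here: the subtree `Tsub` of the complete ℝ-tree `Tb`, whose metric
completion `T̄` is `Tb`) with a very small, minimal, isometric action of the free group
`F(𝒜)` with dense orbits.  (For actions with dense orbits, "very small" is equivalent to
"trivial arc stabilizers".) -/
structure TreeSetup (ι : Type) where
  Tb : Type
  [ms : MetricSpace Tb]
  complete : CompleteSpace Tb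
  tree : IsRTree Tb
  [act : MulAction (FreeGroup ι) Tb]
  act_isom : ∀ g : FreeGroup ι, Isometry fun x : Tb => g • x
  Tsub : Set Tb
  nonempty : Tsub.Nonempty
  dense : Dense Tsub
  sub_subtree : IsSubtree Tsub
  invariant : ∀ g : FreeGroup ι, ∀ x ∈ Tsub, g • x ∈ Tsub
  minimal : ∀ A : Set Tb, A ⊆ Tsub → A.Nonempty → IsSubtree A →
      (∀ g : FreeGroup ι, ∀ x ∈ A, g • x ∈ A) → A = Tsub
  dense_orbits : ∀ x ∈ Tsub, Tsub ⊆ closure (Set.range fun g : FreeGroup ι => g • x)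
  arc_stab : ∀ g : FreeGroup ι, ∀ x ∈ Tsub, ∀ y ∈ Tsub, x ≠ y →
      (fun p => g • p) '' seg x y = seg x y → g = 1

attribute [instance] TreeSetup.ms TreeSetup.act

/-- `𝒬(X) = Q` (for `Q ∈ T̄`), where `𝒬 : ∂F_N → T̂` is the map of Levitt–Lustig:
it is characterized by the property that whenever a sequence `uₙ ∈ F_N` converges to
`X ∈ ∂F_N` and `uₙ P` converges metrically in `T̄` to a point `Q`, then `𝒬(X) = Q`. -/
def QRel {ι : Type} [DecidableEq ι] (St : TreeSetup ι) (X : InfWord ι) (Q : St.Tb) : Prop :=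
  ∃ P ∈ St.Tsub, ∃ u : ℕ → FreeGroup ι, TendstoBoundary u X ∧
    Tendsto (fun n => u n • P) atTop (𝓝 Q)

/-- The limit set `Ω_𝒜 = 𝒬²(C²_𝒜 ∩ L²(T)) ⊆ T̄`: images of pairs of distinct boundary
points with distinct first letters (w.r.t. the basis `𝒜`) that are identified by `𝒬`. -/
def limitSet {ι : Type} [DecidableEq ι] (St : TreeSetup ι) : Set St.Tb :=
  {Q | ∃ X Y : InfWord ι, X.letter 0 ≠ Y.letter 0 ∧ QRel St X Q ∧ QRel St Y Q}

/-- The heart `K_𝒜 ⊆ T̄`: the convex hull of the limit set `Ω_𝒜`. -/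
def heart {ι : Type} [DecidableEq ι] (St : TreeSetup ι) : Set St.Tb :=
  subtreeHull (limitSet St)

/-- The dual algebraic lamination `L²(T) = {(X,Y) ∈ ∂²F_N : 𝒬(X) = 𝒬(Y)}`. -/
def L2 {ι : Type} [DecidableEq ι] (St : TreeSetup ι) : Set (InfWord ι × InfWord ι) :=
  {p | p.1 ≠ p.2 ∧ ∃ Q : St.Tb, QRel St p.1 Q ∧ QRel St p.2 Q}

/-! ### The system of isometries induced on a compact subtree `K ⊆ T̄` -/

/-- The domain, inside `T̄`, of the partial isometry `x ↦ w⁻¹ x` of `K` induced by the word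
`w`: the intersection of the translates of `K` by the prefixes of `w`. -/
def inducedDom {ι : Type} [DecidableEq ι] (St : TreeSetup ι) (K : Set St.Tb)
    (w : FreeGroup ι) : Set St.Tb :=
  ⋂ n ∈ Finset.range (w.toWord.length + 1), gprefix w n • K

/-- Admissibility of a word for the induced system of isometries `𝒦 = (K, 𝒜)`. -/
def InducedAdmissible {ι : Type} [DecidableEq ι] (St : TreeSetup ι) (K : Set St.Tb)
    (w : FreeGroup ι) : Prop :=
  (inducedDom St K w).Nonempty

/-- The admissible laminary language `ℒ_adm(𝒦)` of the induced system `𝒦 = (K, 𝒜)`. -/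
def inducedAdmLanguage {ι : Type} [DecidableEq ι] (St : TreeSetup ι) (K : Set St.Tb) :
    Set (FreeGroup ι) :=
  {w | ∀ k : ℕ, ∃ v : FreeGroup ι, InducedAdmissible St K v ∧
      ∃ p s : List (ι × Bool), p.length = k ∧ s.length = k ∧
        v.toWord = p ++ w.toWord ++ s}

/-- Admissibility of an infinite word for the induced system `𝒦 = (K, 𝒜)`. -/
def InducedAdmissibleInf {ι : Type} [DecidableEq ι] (St : TreeSetup ι) (K : Set St.Tb)
    (X : InfWord ι) : Prop :=
  ∀ n, InducedAdmissible St K (X.prefixN n)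

/-- The domain `dom(X) = ⋂ₙ dom(Xₙ)` of an infinite word, for the induced system. -/
def inducedDomInf {ι : Type} [DecidableEq ι] (St : TreeSetup ι) (K : Set St.Tb)
    (X : InfWord ι) : Set St.Tb :=
  ⋂ n, X.prefixN n • K

/-- Compatibility of a map `e : K → T'` with the system of partial isometries induced on
`K ⊆ T̄` by the basis `𝒜`: this is condition (2) of Theorem 3.2 for the induced system. -/
def InducedCompat {ι : Type} (St : TreeSetup ι) (K : Set St.Tb) {T' : Type} [MetricSpace T']
    [MulAction (FreeGroup ι) T'] (e : K → T') : Prop :=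
  ∀ (i : ι) (x : K) (h : (FreeGroup.of i)⁻¹ • (x : St.Tb) ∈ K),
    (FreeGroup.of i)⁻¹ • e x = e ⟨(FreeGroup.of i)⁻¹ • (x : St.Tb), h⟩

/-- The tree `T_𝒦` associated to the system of isometries induced on a compact subtree
`K ⊆ T̄`, presented through the characteristic properties of Theorem 3.2 (by which it is
unique), together with the canonical `F(𝒜)`-equivariant morphism `j : T_𝒦 → T̄` restricting
to the identity on `K`. -/
structure InducedAssoc {ι : Type} (St : TreeSetup ι) (K : Set St.Tb) where
  TK : Type
  [ms : MetricSpace TK]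
  tree : IsRTree TK
  [act : MulAction (FreeGroup ι) TK]
  act_isom : ∀ g : FreeGroup ι, Isometry fun x : TK => g • x
  emb : K → TK
  emb_isom : Isometry emb
  emb_subtree : IsSubtree (Set.range emb)
  compat : InducedCompat St K emb
  orbit_meets : ∀ p : TK, ∃ (w : FreeGroup ι) (x : K), p = w • emb x
  seg_cover : ∀ p q : TK, ∃ F : Finset (FreeGroup ι),
      seg p q ⊆ ⋃ w ∈ F, w • Set.range emb
  universal : ∀ (T' : Type) [MetricSpace T'] [MulAction (FreeGroup ι) T'],
      (∀ g : FreeGroup ι, Isometry fun x : T' => g • x) →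
      ∀ e' : K → T', Isometry e' → InducedCompat St K e' →
      ∃! f : TK → T', IsTreeMorphism f ∧
        (∀ (g : FreeGroup ι) (p : TK), f (g • p) = g • f p) ∧
        ∀ x : K, f (emb x) = e' x
  jmap : TK → St.Tb
  jmap_morphism : IsTreeMorphism jmap
  jmap_equivariant : ∀ (g : FreeGroup ι) (p : TK), jmap (g • p) = g • jmap p
  jmap_emb : ∀ x : K, jmap (emb x) = (x : St.Tb)

attribute [instance] InducedAssoc.ms InducedAssoc.act

/-! ### Change of basis -/

/-- Changing the basis of the free group: the same tree, with the action precomposed with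
the automorphism `φ` of `F(𝒜)`.  The heart of `St.twist φ` is the heart of `T` with respect
to the basis `φ(𝒜)`. -/
def TreeSetup.twist {ι : Type} (St : TreeSetup ι) (φ : FreeGroup ι ≃* FreeGroup ι) :
    TreeSetup ι where
  Tb := St.Tb
  ms := St.ms
  complete := St.complete
  tree := St.tree
  act := { smul := fun g x => φ g • x
           one_smul := fun x => by show φ 1 • x = x; rw [map_one, one_smul]
           mul_smul := fun g h x => by
             show φ (g * h) • x = φ g • φ h • x
             rw [map_mul, mul_smul] }
  act_isom := fun g => St.act_isom (φ g)
  Tsub := St.Tsub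
  nonempty := St.nonempty
  dense := St.dense
  sub_subtree := St.sub_subtree
  invariant := fun g x hx => St.invariant (φ g) x hx
  minimal := fun A hA hne hsub hinv => St.minimal A hA hne hsub (fun g x hx => by
    have h : φ (φ.symm g) • x ∈ A := hinv (φ.symm g) x hx
    rwa [MulEquiv.apply_symm_apply] at h)
  dense_orbits := fun x hx => by
    have hr : (Set.range fun g : FreeGroup ι => φ g • x) =
        Set.range fun g : FreeGroup ι => g • x := by
      apply Set.ext; intro y
      constructor
      · rintro ⟨g, rfl⟩; exact ⟨φ g, rfl⟩
      · rintro ⟨g, rfl⟩; exact ⟨φ.symm g, by simp⟩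
    show St.Tsub ⊆ closure (Set.range fun g : FreeGroup ι => φ g • x)
    rw [hr]; exact St.dense_orbits x hx
  arc_stab := fun g x hx y hy hxy him => by
    have h1 : φ g = 1 := St.arc_stab (φ g) x hx y hy hxy him
    have h2 := congrArg φ.symm h1
    simpa using h2

/-! ### The boundary `∂T`, the space `T̂ = T̄ ∪ ∂T` and the observers' topology -/

/-- An isometric ray (parametrized on `[0,∞)`) in a metric space. -/
def IsRay {T : Type} [MetricSpace T] (r : ℝ → T) : Prop :=
  ∀ s t : ℝ, 0 ≤ s → 0 ≤ t → dist (r s) (r t) = |s - t|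

/-- The type of isometric rays in `T`. -/
def Ray (T : Type) [MetricSpace T] : Type := {r : ℝ → T // IsRay r}

/-- Two rays define the same end iff they are at bounded distance. -/
def rayEnd (T : Type) [MetricSpace T] : Setoid (Ray T) where
  r := fun r₁ r₂ => ∃ C : ℝ, ∀ t : ℝ, 0 ≤ t → dist (r₁.1 t) (r₂.1 t) ≤ C
  iseqv := by
    refine ⟨fun r => ⟨0, fun t _ => by simp⟩, ?_, ?_⟩
    · rintro r₁ r₂ ⟨C, hC⟩
      exact ⟨C, fun t ht => by rw [dist_comm]; exact hC t ht⟩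
    · rintro r₁ r₂ r₃ ⟨C, hC⟩ ⟨D, hD⟩
      exact ⟨C + D, fun t ht =>
        (dist_triangle _ (r₂.1 t) _).trans (add_le_add (hC t ht) (hD t ht))⟩

/-- The Gromov boundary `∂T`: ends of `T`, i.e. classes of rays at bounded distance. -/
def GromovBoundary (T : Type) [MetricSpace T] : Type := Quotient (rayEnd T)

/-- The space `T̂ = T̄ ∪ ∂T` (for `T` a complete ℝ-tree, representing the completion `T̄`). -/
def TreeHat (T : Type) [MetricSpace T] : Type := T ⊕ GromovBoundary T

/-- The segment `[x, ξ]` from a point `x ∈ T̄` to a boundary point `ξ ∈ ∂T`. -/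
def raySeg {T : Type} [MetricSpace T] (x : T) (ξ : GromovBoundary T) : Set (TreeHat T) :=
  ({Sum.inr ξ} : Set (TreeHat T)) ∪ Sum.inl ''
    {p | ∃ r : Ray T, Quotient.mk (rayEnd T) r = ξ ∧ r.1 0 = x ∧ ∃ t : ℝ, 0 ≤ t ∧ r.1 t = p}

/-- The segment `[ξ, η]` between two boundary points. -/
def lineSeg {T : Type} [MetricSpace T] (ξ η : GromovBoundary T) : Set (TreeHat T) :=
  ({Sum.inr ξ, Sum.inr η} : Set (TreeHat T)) ∪ Sum.inl ''
    {p | ∃ r r' : Ray T, Quotient.mk (rayEnd T) r = ξ ∧ Quotient.mk (rayEnd T) r' = η ∧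
      r.1 0 = p ∧ r'.1 0 = p ∧ ∀ s t : ℝ, 0 ≤ s → 0 ≤ t → dist (r.1 s) (r'.1 t) = s + t}

/-- The segment `[P, Q]` between two points of `T̂ = T̄ ∪ ∂T`. -/
def segHat {T : Type} [MetricSpace T] : TreeHat T → TreeHat T → Set (TreeHat T)
  | Sum.inl x, Sum.inl y => Sum.inl '' seg x y
  | Sum.inl x, Sum.inr ξ => raySeg x ξ
  | Sum.inr ξ, Sum.inl x => raySeg x ξ
  | Sum.inr ξ, Sum.inr η => lineSeg ξ η

/-- The observers' topology on `T̂`: generated by the set of directions, where the direction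
at `P` containing `x` is the set of points `y` with `P ∉ [x,y]` (i.e. the connected component
of `T̂ ∖ {P}` containing `x`). -/
def observersTopology (T : Type) [MetricSpace T] : TopologicalSpace (TreeHat T) :=
  TopologicalSpace.generateFrom
    {D | ∃ P x : TreeHat T, x ≠ P ∧ D = {y | y ≠ P ∧ P ∉ segHat x y}}

/-- The extension to `T̂ = T̄ ∪ ∂T` of an isometric action on `T̄`. -/
def TreeHat.smul {T : Type} [MetricSpace T] {G : Type} [Group G] [MulAction G T]
    (hiso : ∀ g : G, Isometry fun x : T => g • x) (g : G) : TreeHat T → TreeHat T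
  | Sum.inl x => Sum.inl (g • x)
  | Sum.inr ξ => Sum.inr <| Quotient.map'
      (fun r : Ray T => (⟨fun t => g • r.1 t, fun s t hs ht => by
        have h := (hiso g).dist_eq (r.1 s) (r.1 t)
        simpa using h.trans (r.2 s t hs ht)⟩ : Ray T))
      (fun r r' h => by
        obtain ⟨C, hC⟩ := h
        exact ⟨C, fun t ht => by
          have h' := (hiso g).dist_eq (r.1 t) (r'.1 t)
          simpa using h'.le.trans (hC t ht)⟩) ξ

/-! ### Laminations -/

/-- An algebraic lamination (as a set of pairs of boundary points) is closed by diagonal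
leaves. -/
def ClosedByDiagonal {ι : Type} (L : Set (InfWord ι × InfWord ι)) : Prop :=
  ∀ X X' X'' : InfWord ι, (X, X') ∈ L → (X', X'') ∈ L → X = X'' ∨ (X, X'') ∈ L

/-- Invariance of a lamination under the `F(𝒜)`-action on `∂²F(𝒜)`. -/
def InvariantLam {ι : Type} [DecidableEq ι] (L : Set (InfWord ι × InfWord ι)) : Prop :=
  ∀ (w : FreeGroup ι) (X X' Y Y' : InfWord ι), (X, X') ∈ L →
    SmulBoundary w X Y → SmulBoundary w X' Y' → (Y, Y') ∈ L

/-- Invariance of a lamination under the flip map. -/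
def FlipInvariant {ι : Type} (L : Set (InfWord ι × InfWord ι)) : Prop :=
  ∀ X Y : InfWord ι, (X, Y) ∈ L → (Y, X) ∈ L

/-- The dual lamination `L²(T)` is minimal up to diagonal leaves: it contains no proper
non-trivial sublamination that is closed by diagonal leaves. -/
def MinimalUpToDiagonal {ι : Type} [DecidableEq ι] (St : TreeSetup ι) : Prop :=
  ∀ L : Set (InfWord ι × InfWord ι), L ⊆ L2 St → L.Nonempty → IsClosed L →
    InvariantLam L → FlipInvariant L → ClosedByDiagonal L → L = L2 St

end CHL

namespace CHL

section RTree

variable {T : Type*} [MetricSpace T] [IsRTree T]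

/-- A point of a segment in an `ℝ`-tree is determined by its distance to an endpoint. -/
theorem eq_of_mem_seg {x y p q : T} (hp : p ∈ seg x y) (hq : q ∈ seg x y)
    (h : dist x p = dist x q) : p = q := by
  have hp' : dist x p + dist p y = dist x y := hp
  have hq' : dist x q + dist q y = dist x y := hq
  have h4 := IsRTree.four_point p q x y
  rw [dist_comm p x, dist_comm q x] at h4
  have h5 : dist p q ≤ 0 := by
    rcases le_max_iff.1 h4 with h6 | h6 <;> linarith
  exact dist_le_zero.1 h5

/-- An isometry that moves both endpoints of a geodesic by a small amount acts on the middle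
part of the geodesic as a translation. -/
theorem exists_local_translation {γ : ℝ → T} {ε : ℝ} (hε : 0 < ε)
    (hγ : ∀ s ∈ Icc (0 : ℝ) (10 * ε), ∀ t ∈ Icc (0 : ℝ) (10 * ε), dist (γ s) (γ t) = |s - t|)
    {f : T → T} (hf : Isometry f) (h0 : dist (γ 0) (f (γ 0)) ≤ ε)
    (h1 : dist (γ (10 * ε)) (f (γ (10 * ε))) ≤ ε) :
    ∃ t : ℝ, |t| ≤ ε ∧ ∀ s ∈ Icc (3 * ε) (7 * ε), f (γ s) = γ (s + t) := by
  have m0 : (0 : ℝ) ∈ Icc (0 : ℝ) (10 * ε) := ⟨le_rfl, by linarith⟩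
  have m1 : 10 * ε ∈ Icc (0 : ℝ) (10 * ε) := ⟨by linarith, le_rfl⟩
  obtain ⟨x, hx⟩ : ∃ x, x = γ 0 := ⟨_, rfl⟩
  obtain ⟨y, hy⟩ : ∃ y, y = γ (10 * ε) := ⟨_, rfl⟩
  have hd : ∀ s ∈ Icc (0 : ℝ) (10 * ε), dist x (γ s) = s ∧ dist (γ s) y = 10 * ε - s := by
    intro s hs
    rw [hx, hy, hγ _ m0 _ hs, hγ _ hs _ m1, zero_sub, abs_neg, abs_of_nonneg hs.1,
      abs_sub_comm, abs_of_nonneg (by linarith [hs.2])]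
    exact ⟨rfl, rfl⟩
  rw [← hx] at h0
  rw [← hy] at h1
  have hxy : dist x y = 10 * ε := by rw [hy]; exact (hd _ m1).1
  have fxy : dist (f x) (f y) = 10 * ε := by rw [hf.dist_eq, hxy]
  have t1 := dist_triangle x (f x) (f y)
  have t2 := dist_triangle x y (f y)
  have t3 := dist_triangle (f x) x y
  have t4 := dist_triangle x (f x) y
  have t5 := dist_triangle (f x) (f y) y
  have t6 := dist_triangle (f x) y (f y)
  have c1 := dist_comm x (f x)
  have c2 := dist_comm y (f y)
  have q1 : dist x (f y) + dist (f x) y = 2 * (10 * ε) := by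
    have a1 := IsRTree.four_point x y (f x) (f y)
    have a2 := IsRTree.four_point x (f y) (f x) y
    rw [dist_comm y (f x)] at a1
    rw [dist_comm (f y) y, dist_comm (f y) (f x)] at a2
    apply le_antisymm
    · rcases le_max_iff.1 a2 with h | h <;> linarith
    · rcases le_max_iff.1 a1 with h | h <;> linarith
  refine ⟨10 * ε - dist (f x) y, abs_le.2 ⟨by linarith, by linarith⟩, fun s hs => ?_⟩
  have hs' : s ∈ Icc (0 : ℝ) (10 * ε) := ⟨by linarith [hs.1], by linarith [hs.2]⟩
  have hst : s + (10 * ε - dist (f x) y) ∈ Icc (0 : ℝ) (10 * ε) :=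
    ⟨by linarith [hs.1], by linarith [hs.2]⟩
  have e1 : dist (f x) (f (γ s)) = s := by rw [hf.dist_eq, (hd s hs').1]
  have e2 : dist (f (γ s)) (f y) = 10 * ε - s := by rw [hf.dist_eq, (hd s hs').2]
  generalize f (γ s) = p at *
  have u1 := dist_triangle (f x) x p
  have u2 := dist_triangle x (f x) p
  have u3 := dist_triangle p (f y) y
  have u4 := dist_triangle p y (f y)
  have ea : dist x p = s + (10 * ε - dist (f x) y) := by
    have a1 := IsRTree.four_point p (f x) x y
    have a2 := IsRTree.four_point p x (f x) y
    rw [dist_comm p (f x), dist_comm p x] at a1 a2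
    have := hs.1
    apply le_antisymm
    · rcases le_max_iff.1 a2 with h | h <;> linarith
    · rcases le_max_iff.1 a1 with h | h <;> linarith
  have eb : dist p y = (10 * ε - s) + (10 * ε - dist x (f y)) := by
    have a1 := IsRTree.four_point p (f y) y x
    have a2 := IsRTree.four_point p y (f y) x
    rw [dist_comm (f y) x, dist_comm p x, dist_comm y x] at a1 a2
    have := hs.2
    apply le_antisymm
    · rcases le_max_iff.1 a2 with h | h <;> linarith
    · rcases le_max_iff.1 a1 with h | h <;> linarith
  refine eq_of_mem_seg (x := x) (y := y) (show _ + _ = _ by linarith) (show _ + _ = _ from ?_) ?_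
  · rw [(hd _ hst).1, (hd _ hst).2, hxy]; ring
  · rw [(hd _ hst).1, ea]

/-- An element that translates a point by `t` and whose square translates it by `2 * t` acts
as a translation by `t` on the orbit of this point. -/
theorem dist_pow_smul_of_dist_sq_smul {G : Type*} [Group G] [MulAction G T]
    (hiso : ∀ g : G, Isometry fun x : T => g • x) {g : G} {z : T} {t : ℝ} (ht : 0 < t)
    (h1 : dist z (g • z) = t) (h2 : dist z (g ^ 2 • z) = 2 * t) (n : ℕ) :
    dist z (g ^ n • z) = n * t ∧ dist z (g ^ (n + 1) • z) = (n + 1) * t := by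
  have hi : ∀ (m k : ℕ), dist (g ^ m • z) (g ^ (m + k) • z) = dist z (g ^ k • z) := by
    intro m k
    rw [pow_add, mul_smul]
    exact (hiso (g ^ m)).dist_eq _ _
  induction n with
  | zero => simp [h1]
  | succ n ih =>
    refine ⟨by rw [ih.2]; push_cast; ring, ?_⟩
    have a1 := hi n 1
    have a2 := hi (n + 1) 1
    have a3 := hi n 2
    rw [pow_one, h1] at a1 a2
    rw [h2] at a3
    have h4 := IsRTree.four_point z (g ^ (n + 1) • z) (g ^ n • z) (g ^ (n + 1 + 1) • z)
    have h5 := dist_triangle z (g ^ (n + 1) • z) (g ^ (n + 1 + 1) • z)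
    rw [show n + 2 = n + 1 + 1 from rfl] at a3
    rw [a3, ih.1, ih.2, a2, dist_comm (g ^ (n + 1) • z), a1] at h4
    rw [ih.2, a2] at h5
    push_cast
    apply le_antisymm
    · linarith
    · rcases le_max_iff.1 h4 with h | h <;> linarith

end RTree

/-- A commutative free group is cyclic. -/
theorem isCyclic_of_isFreeGroup_of_comm {G : Type*} [Group G] [IsFreeGroup G]
    (hcomm : ∀ a b : G, a * b = b * a) : ∃ c : G, ∀ g : G, ∃ k : ℤ, c ^ k = g := by
  have e : FreeGroup (IsFreeGroup.Generators G) ≃* G := IsFreeGroup.mulEquiv G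
  have hsub : Subsingleton (IsFreeGroup.Generators G) := by
    classical
    refine ⟨fun a b => ?_⟩
    by_contra hab
    have h : FreeGroup.of a * FreeGroup.of b = FreeGroup.of b * FreeGroup.of a :=
      e.injective (by rw [map_mul, map_mul, hcomm])
    let φ : FreeGroup (IsFreeGroup.Generators G) →* Equiv.Perm (Fin 3) :=
      FreeGroup.lift fun i => if i = a then Equiv.swap 0 1 else Equiv.swap 1 2
    have h' := congrArg φ h
    simp only [map_mul, φ, FreeGroup.lift_apply_of, if_true, if_neg (Ne.symm hab)] at h'
    revert h'
    decide
  rcases isEmpty_or_nonempty (IsFreeGroup.Generators G) with hE | ⟨⟨a⟩⟩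
  · exact ⟨1, fun g => ⟨0, e.symm.injective (Subsingleton.elim _ _)⟩⟩
  · have : Unique (IsFreeGroup.Generators G) := ⟨⟨a⟩, fun b => Subsingleton.elim _ _⟩
    obtain ⟨c, hc⟩ := IsCyclic.exists_generator (α := FreeGroup (IsFreeGroup.Generators G))
    refine ⟨e c, fun g => ?_⟩
    obtain ⟨k, hk⟩ := Subgroup.mem_zpowers_iff.1 (hc (e.symm g))
    exact ⟨k, by rw [← map_zpow, hk, MulEquiv.apply_symm_apply]⟩

/-- Let a free group act by isometries on an `ℝ`-tree so that no non-trivial element fixes two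
distinct points.  Then only finitely many elements move both endpoints of a given
non-degenerate geodesic by a small amount. -/
theorem finite_setOf_small_displacement {T : Type*} [MetricSpace T] [IsRTree T]
    {G : Type*} [Group G] [IsFreeGroup G] [MulAction G T]
    (hiso : ∀ g : G, Isometry fun x : T => g • x)
    (hfix : ∀ (g : G) (p q : T), p ≠ q → g • p = p → g • q = q → g = 1)
    {γ : ℝ → T} {ε : ℝ} (hε : 0 < ε)
    (hγ : ∀ s ∈ Icc (0 : ℝ) (10 * ε), ∀ t ∈ Icc (0 : ℝ) (10 * ε), dist (γ s) (γ t) = |s - t|) :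
    {g : G | dist (γ 0) (g • γ 0) ≤ ε ∧ dist (γ (10 * ε)) (g • γ (10 * ε)) ≤ ε}.Finite := by
  set S : Set G :=
    {g : G | dist (γ 0) (g • γ 0) ≤ ε ∧ dist (γ (10 * ε)) (g • γ (10 * ε)) ≤ ε} with hS
  have htr : ∀ g ∈ S, ∃ t : ℝ, |t| ≤ ε ∧ ∀ s ∈ Icc (3 * ε) (7 * ε), g • γ s = γ (s + t) :=
    fun g hg => exists_local_translation hε hγ (hiso g) hg.1 hg.2
  have hne : γ (4 * ε) ≠ γ (5 * ε) := by
    rw [← dist_pos, hγ _ ⟨by linarith, by linarith⟩ _ ⟨by linarith, by linarith⟩]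
    exact abs_pos.2 (by linarith)
  have hcomm : ∀ g ∈ S, ∀ h ∈ S, g * h = h * g := by
    intro g hg h hh
    obtain ⟨t, ht, htg⟩ := htr g hg
    obtain ⟨u, hu, huh⟩ := htr h hh
    rw [abs_le] at ht hu
    have key : ∀ s ∈ Icc (4 * ε) (6 * ε), (h * g)⁻¹ • (g * h) • γ s = γ s := by
      intro s hs
      rw [inv_smul_eq_iff, mul_smul, mul_smul, huh s ⟨by linarith [hs.1], by linarith [hs.2]⟩,
        htg s ⟨by linarith [hs.1], by linarith [hs.2]⟩,
        huh _ ⟨by linarith [hs.1], by linarith [hs.2]⟩,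
        htg _ ⟨by linarith [hs.1], by linarith [hs.2]⟩]
      congr 1
      ring
    have h1 := hfix ((h * g)⁻¹ * (g * h)) _ _ hne
      (by rw [mul_smul]; exact key _ ⟨le_rfl, by linarith⟩)
      (by rw [mul_smul]; exact key _ ⟨by linarith, by linarith⟩)
    exact (inv_mul_eq_one.1 h1).symm
  obtain ⟨c, hc⟩ : ∃ c : G, ∀ g ∈ S, ∃ k : ℤ, c ^ k = g := by
    have hH := Subgroup.isMulCommutative_closure hcomm
    obtain ⟨c, hc⟩ := isCyclic_of_isFreeGroup_of_comm (G := Subgroup.closure S)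
      (fun a b => hH.is_comm.comm a b)
    refine ⟨c, fun g hg => ?_⟩
    obtain ⟨k, hk⟩ := hc ⟨g, Subgroup.subset_closure hg⟩
    exact ⟨k, by simpa using congrArg Subtype.val hk⟩
  by_cases htriv : S ⊆ {1}
  · exact (finite_singleton 1).subset htriv
  obtain ⟨h, hh, h1⟩ := not_subset.1 htriv
  obtain ⟨t, ht, hth⟩ := htr h hh
  have ht0 : t ≠ 0 := by
    rintro rfl
    refine h1 (hfix h _ _ hne ?_ ?_)
    · rw [hth _ ⟨by linarith, by linarith⟩, add_zero]
    · rw [hth _ ⟨by linarith, by linarith⟩, add_zero]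
  obtain ⟨z, hz⟩ : ∃ z, z = γ (5 * ε) := ⟨_, rfl⟩
  rw [abs_le] at ht
  have d1 : dist z (h • z) = |t| := by
    rw [hz, hth _ ⟨by linarith, by linarith⟩,
      hγ _ ⟨by linarith, by linarith⟩ _ ⟨by linarith, by linarith⟩, ← abs_neg]
    congr 1
    ring
  have d2 : dist z (h ^ 2 • z) = 2 * |t| := by
    rw [pow_two, mul_smul, hz, hth _ ⟨by linarith, by linarith⟩,
      hth _ ⟨by linarith, by linarith⟩,
      hγ _ ⟨by linarith, by linarith⟩ _ ⟨by linarith, by linarith⟩,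
      show 5 * ε - (5 * ε + t + t) = (-2) * t by ring, abs_mul]
    norm_num
  have hpow := fun n : ℕ => (dist_pow_smul_of_dist_sq_smul hiso (abs_pos.2 ht0) d1 d2 n).1
  have hzpow : ∀ n : ℤ, dist z (h ^ n • z) = |(n : ℝ)| * |t| := by
    intro n
    obtain ⟨m, rfl | rfl⟩ := n.eq_nat_or_neg
    · simpa using hpow m
    · have := (hiso (h ^ m)).dist_eq z (h ^ (-(m : ℤ)) • z)
      simp only [zpow_neg, zpow_natCast, smul_inv_smul] at this ⊢
      rw [← this, dist_comm, hpow]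
      simp
  obtain ⟨p, rfl⟩ := hc h hh
  have hp : p ≠ 0 := by
    rintro rfl
    exact h1 (by simp)
  have hsmall : ∀ g ∈ S, dist z (g • z) ≤ ε := by
    intro g hg
    obtain ⟨u, hu, hug⟩ := htr g hg
    have hu' := abs_le.1 hu
    rw [hz, hug _ ⟨by linarith, by linarith⟩,
      hγ _ ⟨by linarith, by linarith⟩ _ ⟨by linarith, by linarith⟩, ← abs_neg]
    convert hu using 2
    ring
  obtain ⟨M, hM⟩ := ((Finset.Ico 0 |p|).image fun r => dist z (c ^ r • z)).exists_le
  obtain ⟨B, hB⟩ := exists_nat_ge ((M + ε) / |t|)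
  rw [div_le_iff₀ (abs_pos.2 ht0)] at hB
  refine (((finite_Icc (-(B : ℤ)) B).prod (finite_Ico (0 : ℤ) |p|)).image
    fun q => c ^ (p * q.1 + q.2)).subset fun g hg => ?_
  obtain ⟨k, rfl⟩ := hc g hg
  have hr : k % p ∈ Finset.Ico 0 |p| :=
    Finset.mem_Ico.2 ⟨Int.emod_nonneg k hp, Int.emod_lt_abs k hp⟩
  refine ⟨(k / p, k % p), ⟨?_, by simpa using hr⟩, by simp only [Int.mul_ediv_add_emod]⟩
  have e1 := (hiso (c ^ (k % p))).dist_eq z ((c ^ p) ^ (k / p) • z)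
  simp only [← mul_smul, ← zpow_mul, ← zpow_add, Int.emod_add_mul_ediv] at e1
  have e2 := hzpow (k / p)
  rw [← zpow_mul, ← e1] at e2
  have e3 := dist_triangle_left (c ^ (k % p) • z) (c ^ k • z) z
  have e4 := hM _ (Finset.mem_image_of_mem _ hr)
  have e5 := hsmall _ hg
  have e6 : |((k / p : ℤ) : ℝ)| ≤ B :=
    le_of_mul_le_mul_right (by linarith) (abs_pos.2 ht0)
  rw [mem_Icc, ← abs_le]
  exact_mod_cast e6

/-- A dense subtree of an `ℝ`-tree contains the interior of every segment. -/
theorem mem_of_mem_seg_of_dense {T : Type*} [MetricSpace T] [IsRTree T] {A : Set T}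
    (hA : Dense A) (hAt : IsSubtree A) {p q m : T} (hm : m ∈ seg p q) (hmp : m ≠ p)
    (hmq : m ≠ q) : m ∈ A := by
  have hm' : dist p m + dist m q = dist p q := hm
  have dp : 0 < dist p m := dist_pos.2 hmp.symm
  have dq : 0 < dist m q := dist_pos.2 hmq
  obtain ⟨δ, hδ, hδp, hδq⟩ : ∃ δ > 0, 2 * δ < dist p m ∧ 2 * δ < dist m q :=
    ⟨min (dist p m) (dist m q) / 4, by positivity,
      by linarith [min_le_left (dist p m) (dist m q)],
      by linarith [min_le_right (dist p m) (dist m q)]⟩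
  obtain ⟨x, hx, hpx⟩ := hA.exists_dist_lt p hδ
  obtain ⟨y, hy, hqy⟩ := hA.exists_dist_lt q hδ
  refine hAt x hx y hy (show _ + _ = _ from ?_)
  have b1 := dist_triangle p x m
  have b2 := dist_triangle m y q
  have b3 := dist_triangle p x q
  have b4 := dist_triangle p y q
  have c1 := dist_comm p y
  have c2 := dist_comm q y
  have a1 := IsRTree.four_point x m p q
  have a2 := IsRTree.four_point y m p q
  have a3 := IsRTree.four_point x q p y
  rw [dist_comm x p] at a1 a3
  rw [dist_comm y m, dist_comm y p, dist_comm y q, dist_comm m p] at a2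
  rw [dist_comm m p] at a1
  rw [dist_comm q p] at a3
  apply le_antisymm _ (dist_triangle x m y)
  rcases le_max_iff.1 a1 with h1 | h1 <;> rcases le_max_iff.1 a2 with h2 | h2 <;>
    rcases le_max_iff.1 a3 with h3 | h3 <;> linarith

/-- Only the trivial element fixes two distinct points of the completion. -/
theorem TreeSetup.eq_one_of_fixes {ι : Type} (St : TreeSetup ι) (g : FreeGroup ι) (p q : St.Tb)
    (hpq : p ≠ q) (hp : g • p = p) (hq : g • q = q) : g = 1 := by
  have := St.tree
  have hL : 0 < dist p q := dist_pos.2 hpq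
  obtain ⟨γ, h0, h1, hγ⟩ := IsRTree.geodesic p q
  have m0 : (0 : ℝ) ∈ Icc 0 (dist p q) := ⟨le_rfl, hL.le⟩
  have m1 : dist p q ∈ Icc 0 (dist p q) := ⟨hL.le, le_rfl⟩
  have key : ∀ s, 0 < s → s < dist p q → γ s ∈ St.Tsub ∧ g • γ s = γ s := by
    intro s hs hs'
    have ms : s ∈ Icc 0 (dist p q) := ⟨hs.le, hs'.le⟩
    have e1 : dist p (γ s) = s := by
      have := hγ _ m0 _ ms
      rwa [h0, zero_sub, abs_neg, abs_of_pos hs] at this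
    have e2 : dist (γ s) q = dist p q - s := by
      have := hγ _ ms _ m1
      rwa [h1, abs_sub_comm, abs_of_pos (by linarith)] at this
    have hseg : γ s ∈ seg p q := show _ + _ = _ by rw [e1, e2]; ring
    refine ⟨mem_of_mem_seg_of_dense St.dense St.sub_subtree hseg ?_ ?_, ?_⟩
    · rw [← dist_pos, dist_comm, e1]; exact hs
    · rw [← dist_pos, e2]; linarith
    · have f1 := (St.act_isom g).dist_eq p (γ s)
      have f2 := (St.act_isom g).dist_eq (γ s) q
      simp only [hp, hq] at f1 f2
      exact eq_of_mem_seg (show _ + _ = _ by rw [f1, f2]; exact hseg) hseg f1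
  obtain ⟨a1, a2⟩ := key (dist p q / 3) (by linarith) (by linarith)
  obtain ⟨b1, b2⟩ := key (dist p q / 2) (by linarith) (by linarith)
  refine St.arc_stab g _ a1 _ b1 ?_ ?_
  · rw [← dist_pos, hγ _ ⟨by linarith, by linarith⟩ _ ⟨by linarith, by linarith⟩]
    exact abs_pos.2 (by linarith)
  · have hsub : ∀ (h : FreeGroup ι) (x y : St.Tb), h • x = x → h • y = y →
        ∀ z ∈ seg x y, h • z ∈ seg x y := by
      intro h x y hx hy z hz
      have f1 := (St.act_isom h).dist_eq x z
      have f2 := (St.act_isom h).dist_eq z y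
      simp only [hx, hy] at f1 f2
      exact show _ + _ = _ by rw [f1, f2]; exact hz
    apply Subset.antisymm
    · rintro _ ⟨z, hz, rfl⟩
      exact hsub g _ _ a2 b2 z hz
    · intro z hz
      exact ⟨g⁻¹ • z, hsub g⁻¹ _ _ (inv_smul_eq_iff.2 a2.symm) (inv_smul_eq_iff.2 b2.symm) z hz,
        smul_inv_smul g z⟩

section InfWord

variable {ι : Type*} [DecidableEq ι] (X : InfWord ι)

theorem InfWord.toWord_prefixN (n : ℕ) :
    (X.prefixN n).toWord = List.ofFn fun i : Fin n => X.letter i := by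
  rw [InfWord.prefixN, FreeGroup.toWord_mk, ← FreeGroup.isReduced_iff_reduce_eq,
    FreeGroup.IsReduced, List.isChain_iff_getElem]
  intro i hi h1
  simp only [List.getElem_ofFn] at h1 ⊢
  by_contra h2
  exact X.reduced i ⟨h1, by rw [Bool.eq_not]; exact h2⟩

theorem InfWord.prefixN_injective : Function.Injective X.prefixN := fun m n h => by
  simpa [X.toWord_prefixN] using congrArg (fun w => w.toWord.length) h

theorem InfWord.gprefix_prefixN {m n : ℕ} (h : m ≤ n) :
    gprefix (X.prefixN n) m = X.prefixN m := by
  rw [gprefix, X.toWord_prefixN, InfWord.prefixN]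
  congr 1
  apply List.ext_getElem <;> simp [h]

end InfWord

theorem inducedDom_prefixN {ι : Type} [DecidableEq ι] (St : TreeSetup ι) (K : Set St.Tb)
    (X : InfWord ι) (n : ℕ) :
    inducedDom St K (X.prefixN n) = ⋂ m ∈ Finset.range (n + 1), X.prefixN m • K := by
  rw [inducedDom, X.toWord_prefixN, List.length_ofFn]
  refine iInter₂_congr fun m hm => ?_
  rw [X.gprefix_prefixN (Nat.lt_succ_iff.1 (Finset.mem_range.1 hm))]

theorem TreeSetup.isCompact_smul {ι : Type} (St : TreeSetup ι) {K : Set St.Tb}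
    (hK : IsCompact K) (g : FreeGroup ι) : IsCompact (g • K) :=
  hK.image (St.act_isom g).continuous

/-- The domain of an admissible infinite word is non-empty. -/
theorem inducedDomInf_nonempty {ι : Type} [DecidableEq ι] (St : TreeSetup ι) {K : Set St.Tb}
    (hK : IsCompact K) {X : InfWord ι} (hX : InducedAdmissibleInf St K X) :
    (inducedDomInf St K X).Nonempty := by
  have hcl : ∀ n, IsClosed (⋂ m ∈ Finset.range (n + 1), X.prefixN m • K) := fun n =>
    isClosed_biInter fun m _ => (St.isCompact_smul hK _).isClosed
  obtain ⟨x, hx⟩ := IsCompact.nonempty_iInter_of_sequence_nonempty_isCompact_isClosed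
    (fun n => ⋂ m ∈ Finset.range (n + 1), X.prefixN m • K)
    (fun n => biInter_subset_biInter_left
      (by simp))
    (fun n => by rw [← inducedDom_prefixN]; exact hX n)
    ((St.isCompact_smul hK (X.prefixN 0)).of_isClosed_subset (hcl 0)
      (biInter_subset_of_mem (by simp)))
    hcl
  refine ⟨x, mem_iInter.2 fun n => ?_⟩
  exact mem_iInter₂.1 (mem_iInter.1 hx n) n (by simp)

/-- The domain of an infinite word has at most one point. -/
theorem inducedDomInf_subsingleton {ι : Type} [DecidableEq ι] (St : TreeSetup ι) {K : Set St.Tb}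
    (hK : IsCompact K) (X : InfWord ι) : (inducedDomInf St K X).Subsingleton := by
  have := St.tree
  intro x hx y hy
  by_contra hxy
  obtain ⟨γ, h0, h1, hγ⟩ := IsRTree.geodesic x y
  obtain ⟨ε, hε⟩ : ∃ ε, ε = dist x y / 10 := ⟨_, rfl⟩
  have hL : dist x y = 10 * ε := by rw [hε]; ring
  have hpos : 0 < ε := by rw [hε]; exact div_pos (dist_pos.2 hxy) (by norm_num)
  rw [hL] at h1 hγ
  have hfin := finite_setOf_small_displacement St.act_isom St.eq_one_of_fixes hpos hγ
  rw [h0, h1] at hfin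
  have hmem : ∀ z ∈ inducedDomInf St K X, ∀ n, (X.prefixN n)⁻¹ • z ∈ K := fun z hz n =>
    mem_smul_set_iff_inv_smul_mem.1 (mem_iInter.1 hz n)
  obtain ⟨l, -, φ, hφ, hlim⟩ := (hK.prod hK).tendsto_subseq
    (x := fun n => ((X.prefixN n)⁻¹ • x, (X.prefixN n)⁻¹ • y))
    fun n => ⟨hmem x hx n, hmem y hy n⟩
  obtain ⟨N, hN⟩ := Metric.cauchySeq_iff'.1 hlim.cauchySeq ε hpos
  refine (infinite_of_injective_forall_mem
    (f := fun n => X.prefixN (φ (N + n)) * (X.prefixN (φ N))⁻¹) ?_ fun n => ?_) hfin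
  · intro m n hmn
    have := hφ.injective (X.prefixN_injective (mul_right_cancel hmn))
    omega
  · have hn := hN (N + n) (by omega)
    simp only [Function.comp_apply, Prod.dist_eq, max_lt_iff] at hn
    have hd : ∀ (g h : FreeGroup ι) (z : St.Tb),
        dist z ((g * h⁻¹) • z) = dist (g⁻¹ • z) (h⁻¹ • z) := by
      intro g h z
      have := (St.act_isom g).dist_eq (g⁻¹ • z) (h⁻¹ • z)
      simpa only [smul_inv_smul, mul_smul] using this
    exact ⟨by rw [hd]; exact hn.1.le, by rw [hd]; exact hn.2.le⟩

/-- **Lemma 5.1.**  The system of isometries induced on a compact subtree `K ⊆ T̄` (with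
`K ∩ aK ≠ ∅` for all `a ∈ 𝒜`) by a very small minimal action of `F_N` (`N ≥ 2`) with dense
orbits has independent generators: every admissible infinite word has a one-point domain. -/
theorem induced_independent_generators {ι : Type} [Fintype ι] [DecidableEq ι]
    (hrank : 2 ≤ Fintype.card ι) (St : TreeSetup ι) (K : Set St.Tb)
    (hKcomp : IsCompact K) (hKtree : IsClosedSubtree K)
    (hKa : ∀ i : ι, (K ∩ FreeGroup.of i • K).Nonempty)
    (X : InfWord ι) (hX : InducedAdmissibleInf St K X) :
    ∃ x : St.Tb, inducedDomInf St K X = {x} := by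
  obtain ⟨x, hx⟩ := inducedDomInf_nonempty St hKcomp hX
  exact ⟨x, (inducedDomInf_subsingleton St hKcomp X).eq_singleton_of_mem hx⟩

end CHL
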